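/- arXiv:math/9603208 — 2 statements merged into one kernel-verified Lean document; each statement's English description precedes it below -/
import Mathlib

section
/- Let x₁,…,x_d be points on the unit sphere in ℝ^d, S = [x₁,…,x_d] their convex hull, rp(S) its radial projection onto the sphere, and [0,S], [0,rp(S)] the cones over these sets with apex 0. Then vol_d([0, rp(S)]) − vol_d([0, S]) ≥ (d²/(2(d+1))) · (1 − ‖(1/d)∑_{i=1}^d x_i‖²) · vol_d([0, S]). -/
open MeasureTheory Real

lemma aux_phi {n g : ℝ} (hn : 0 ≤ n) (hg : n ≤ g) :
    (1 + g) * exp (-g) + exp (-g) * ((g ^ 2 - n ^ 2) / 2) ≤ (1 + n) * exp (-n) := by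
  have h := Real.quadratic_le_exp_of_nonneg (sub_nonneg.2 hg)
  have e : exp (-n) = exp (-g) * exp (g - n) := by rw [← exp_add]; ring_nf
  rw [e]
  have hp := exp_pos (-g)
  have : (1 + g) + ((g ^ 2 - n ^ 2) / 2) ≤ (1 + n) * exp (g - n) := by
    nlinarith [mul_le_mul_of_nonneg_left h (by linarith : 0 ≤ 1 + n), mul_nonneg hn (sq_nonneg (g - n))]
  nlinarith [mul_le_mul_of_nonneg_left this hp.le]

lemma aux_int_Ioi (a : ℝ) (ha : 0 ≤ a) :
    ∫⁻ s in Set.Ioi a, ENNReal.ofReal (s * exp (-s)) = ENNReal.ofReal ((1 + a) * exp (-a)) := by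
  have hd : ∀ x ∈ Set.Ioi a, HasDerivAt (fun s : ℝ => -((1 + s) * exp (-s))) (x * exp (-x)) x := by
    intro x _
    have h1 : HasDerivAt (fun s : ℝ => 1 + s) 1 x := (hasDerivAt_id x).const_add 1
    have h2 : HasDerivAt (fun s : ℝ => exp (-s)) (exp (-x) * (-1)) x := (hasDerivAt_id x).neg.exp
    have := (h1.mul h2).neg
    refine this.congr_deriv ?_
    ring
  have hc : ContinuousWithinAt (fun s : ℝ => -((1 + s) * exp (-s))) (Set.Ici a) a := by
    apply Continuous.continuousWithinAt; fun_prop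
  have hpos : ∀ x ∈ Set.Ioi a, 0 ≤ x * exp (-x) := fun x hx =>
    mul_nonneg (ha.trans (le_of_lt hx)) (exp_pos _).le
  have ht : Filter.Tendsto (fun s : ℝ => -((1 + s) * exp (-s))) Filter.atTop (nhds 0) := by
    have h0 := Real.tendsto_pow_mul_exp_neg_atTop_nhds_zero 0
    have h1 := Real.tendsto_pow_mul_exp_neg_atTop_nhds_zero 1
    have := (h0.add h1).neg
    simp only [add_zero, neg_zero] at this
    refine this.congr fun s => ?_
    ring
  have hI := integral_Ioi_of_hasDerivAt_of_nonneg hc hd hpos ht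
  have hin := integrableOn_Ioi_deriv_of_nonneg hc hd hpos ht
  rw [← ofReal_integral_eq_lintegral_ofReal hin, hI]
  · simp
  · exact (ae_restrict_iff' measurableSet_Ioi).2 (Filter.Eventually.of_forall hpos)

lemma aux_gamma_int (m : ℕ) :
    Integrable (fun t : ℝ => t ^ m * exp (-t)) (volume.restrict (Set.Ici 0)) := by
  have h := Real.GammaIntegral_convergent (s := (m : ℝ) + 1) (by positivity)
  have := (integrableOn_Ici_iff_integrableOn_Ioi).2 h
  refine Integrable.congr this (Filter.Eventually.of_forall fun t => ?_)
  simp [mul_comm]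

lemma aux_gamma_val (m : ℕ) :
    ∫ t in Set.Ici (0:ℝ), t ^ m * exp (-t) = m.factorial := by
  rw [← Real.Gamma_nat_eq_factorial, Real.Gamma_eq_integral (by positivity),
    integral_Ici_eq_integral_Ioi]
  congr 1
  ext t
  simp [mul_comm]

/-- The closed positive orthant. -/
def auxQ (d : ℕ) : Set (Fin d → ℝ) := Set.univ.pi fun _ => Set.Ici 0

lemma auxQ_meas (d : ℕ) : MeasurableSet (auxQ d) :=
  MeasurableSet.univ_pi fun _ => measurableSet_Ici

open scoped Pointwise in
lemma aux_layer (d : ℕ) (N : (Fin d → ℝ) → ℝ) (hN : Measurable N)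
    (h0 : ∀ v ∈ auxQ d, 0 ≤ N v) (hs : ∀ s : ℝ, 0 < s → ∀ v, N (s • v) = s * N v) :
    ∫⁻ v in auxQ d, ENNReal.ofReal ((1 + N v) * exp (-N v)) =
      ENNReal.ofReal ((d + 1).factorial : ℝ) * volume (auxQ d ∩ {v | N v ≤ 1}) := by
  have hscale : ∀ s : ℝ, 0 < s → volume (auxQ d ∩ {v | N v ≤ s}) =
      ENNReal.ofReal (s ^ d) * volume (auxQ d ∩ {v | N v ≤ 1}) := by
    intro s hpos
    have : auxQ d ∩ {v | N v ≤ s} = s • (auxQ d ∩ {v | N v ≤ 1}) := by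
      ext v
      rw [Set.mem_smul_set_iff_inv_smul_mem₀ hpos.ne']
      simp only [auxQ, Set.mem_inter_iff, Set.mem_pi, Set.mem_univ, Set.mem_Ici, Set.mem_ofPred_eq,
        hs _ (inv_pos.2 hpos), Pi.smul_apply, smul_eq_mul, forall_const]
      refine and_congr (forall_congr' fun i => ?_) ?_
      · rw [mul_nonneg_iff_of_pos_left (inv_pos.2 hpos)]
      · rw [inv_mul_le_iff₀ hpos, mul_one]
    rw [this, Measure.addHaar_smul, Module.finrank_fin_fun, abs_of_pos (pow_pos hpos d)]
  have hme : Measurable ({p : (Fin d → ℝ) × ℝ | N p.1 ≤ p.2}.indicator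
        (fun p => ENNReal.ofReal (p.2 * exp (-p.2)))) := by
    refine Measurable.indicator (by fun_prop) ?_
    exact measurableSet_le (by fun_prop) (by fun_prop)
  have step1 : ∀ v ∈ auxQ d, ENNReal.ofReal ((1 + N v) * exp (-N v)) =
      ∫⁻ s in Set.Ioi (0:ℝ), {p : (Fin d → ℝ) × ℝ | N p.1 ≤ p.2}.indicator
        (fun p => ENNReal.ofReal (p.2 * exp (-p.2))) (v, s) := by
    intro v hv
    rw [← aux_int_Ioi _ (h0 v hv)]
    have : ∀ s : ℝ, {p : (Fin d → ℝ) × ℝ | N p.1 ≤ p.2}.indicator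
        (fun p => ENNReal.ofReal (p.2 * exp (-p.2))) (v, s) =
        (Set.Ici (N v)).indicator (fun s => ENNReal.ofReal (s * exp (-s))) s := by
      intro s
      simp [Set.indicator]
    simp_rw [this]
    rw [Measure.restrict_congr_set (Ioi_ae_eq_Ici (a := (0:ℝ))),
      lintegral_indicator measurableSet_Ici, Measure.restrict_restrict measurableSet_Ici,
      Set.inter_eq_left.2 (Set.Ici_subset_Ici.2 (h0 v hv)),
      Measure.restrict_congr_set (Ioi_ae_eq_Ici (a := N v))]
  rw [setLIntegral_congr_fun (auxQ_meas d) step1, lintegral_lintegral_swap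
    (f := fun v s => {p : (Fin d → ℝ) × ℝ | N p.1 ≤ p.2}.indicator
        (fun p => ENNReal.ofReal (p.2 * exp (-p.2))) (v, s)) hme.aemeasurable]
  have step2 : ∀ s ∈ Set.Ioi (0:ℝ),
      ∫⁻ v in auxQ d, {p : (Fin d → ℝ) × ℝ | N p.1 ≤ p.2}.indicator
        (fun p => ENNReal.ofReal (p.2 * exp (-p.2))) (v, s) =
      ENNReal.ofReal (s ^ (d + 1) * exp (-s)) * volume (auxQ d ∩ {v | N v ≤ 1}) := by
    intro s hs0
    have hs0 : 0 < s := hs0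
    have : ∀ v, {p : (Fin d → ℝ) × ℝ | N p.1 ≤ p.2}.indicator
        (fun p => ENNReal.ofReal (p.2 * exp (-p.2))) (v, s) =
        {v | N v ≤ s}.indicator (fun _ => ENNReal.ofReal (s * exp (-s))) v := by
      intro v
      simp [Set.indicator]
    simp_rw [this]
    have hms : MeasurableSet {v | N v ≤ s} := measurableSet_le hN measurable_const
    rw [lintegral_indicator hms, lintegral_const, Measure.restrict_restrict hms,
      Measure.restrict_apply_univ, Set.inter_comm, hscale s hs0, ← mul_assoc,
      ← ENNReal.ofReal_mul (by positivity)]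
    congr 2
    ring
  rw [setLIntegral_congr_fun measurableSet_Ioi step2, lintegral_mul_const _ (by fun_prop)]
  congr 1
  have hi := aux_gamma_int (d + 1)
  have hv := aux_gamma_val (d + 1)
  rw [Measure.restrict_congr_set (Ioi_ae_eq_Ici (a := (0:ℝ))), ← hv,
    ofReal_integral_eq_lintegral_ofReal hi]
  refine (ae_restrict_iff' measurableSet_Ici).2 (Filter.Eventually.of_forall fun t ht => ?_)
  have : 0 ≤ t := ht
  show 0 ≤ t ^ (d + 1) * exp (-t)
  positivity

lemma aux_mono (d : ℕ) (m : Fin d → ℕ) :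
    Integrable (fun v : Fin d → ℝ => (∏ k, v k ^ m k) * exp (-∑ k, v k))
      (volume.restrict (auxQ d)) ∧
    ∫ v in auxQ d, (∏ k, v k ^ m k) * exp (-∑ k, v k) = ∏ k, ((m k).factorial : ℝ) := by
  have e : ∀ v : Fin d → ℝ, (∏ k, v k ^ m k) * exp (-∑ k, v k) =
      ∏ k, (fun t : ℝ => t ^ m k * exp (-t)) (v k) := by
    intro v
    rw [← Finset.sum_neg_distrib, exp_sum, Finset.prod_mul_distrib]
  simp_rw [e]
  rw [auxQ, volume_pi, Measure.restrict_pi_pi]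
  constructor
  · exact Integrable.fintype_prod (f := fun k (t : ℝ) => t ^ m k * exp (-t))
      fun k => aux_gamma_int (m k)
  · rw [integral_fintype_prod_eq_prod (fun k (t : ℝ) => t ^ m k * exp (-t))]
    simp_rw [aux_gamma_val]

lemma aux_mono0 (d : ℕ) :
    Integrable (fun v : Fin d → ℝ => exp (-∑ k, v k)) (volume.restrict (auxQ d)) ∧
    ∫ v in auxQ d, exp (-∑ k, v k) = 1 := by
  simpa using aux_mono d 0

lemma aux_mono1 (d : ℕ) (i : Fin d) :
    Integrable (fun v : Fin d → ℝ => v i * exp (-∑ k, v k)) (volume.restrict (auxQ d)) ∧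
    ∫ v in auxQ d, v i * exp (-∑ k, v k) = 1 := by
  have h := aux_mono d (Pi.single i 1)
  have e : ∀ v : Fin d → ℝ, ∏ k, v k ^ (Pi.single i 1 : Fin d → ℕ) k = v i := by
    intro v
    rw [Finset.prod_eq_single i] <;> simp +contextual [Pi.single_apply]
  have e2 : ∏ k, (((Pi.single i 1 : Fin d → ℕ) k).factorial : ℝ) = 1 := by
    apply Finset.prod_eq_one
    intro k _
    by_cases hk : k = i <;> simp [Pi.single_apply, hk]
  simp_rw [e, e2] at h
  exact h

lemma aux_mono2 (d : ℕ) (i j : Fin d) :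
    Integrable (fun v : Fin d → ℝ => v i * v j * exp (-∑ k, v k)) (volume.restrict (auxQ d)) ∧
    (i ≠ j → ∫ v in auxQ d, v i * v j * exp (-∑ k, v k) = 1) := by
  have h := aux_mono d (Pi.single i 1 + Pi.single j 1)
  have e : ∀ (i : Fin d) (v : Fin d → ℝ), ∏ k, v k ^ (Pi.single i 1 : Fin d → ℕ) k = v i := by
    intro i v
    rw [Finset.prod_eq_single i] <;> simp +contextual [Pi.single_apply]
  simp_rw [Pi.add_apply, pow_add, Finset.prod_mul_distrib, e] at h
  refine ⟨h.1, fun hij => ?_⟩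
  rw [h.2]
  apply Finset.prod_eq_one
  intro k _
  by_cases hk : k = i
  · subst hk; simp [Pi.single_apply, hij]
  · by_cases hk2 : k = j <;> simp [Pi.single_apply, hk, hk2, Ne.symm hij]

/-- The key inequality in coordinates. -/
lemma aux_key (d : ℕ) (x : Fin d → EuclideanSpace ℝ (Fin d)) (hx : ∀ i, ‖x i‖ = 1) :
    ENNReal.ofReal (1 + d + ((d : ℝ) ^ 2 - ‖∑ i, x i‖ ^ 2) / 2) ≤
      ENNReal.ofReal ((d + 1).factorial : ℝ) *
        volume (auxQ d ∩ {v | ‖∑ i, v i • x i‖ ≤ 1}) := by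
  rw [← aux_layer d (fun v => ‖∑ i, v i • x i‖) (by fun_prop) (fun v _ => norm_nonneg _) ?_]
  swap
  · intro s hs v
    simp only [Pi.smul_apply, smul_eq_mul, mul_smul]
    rw [← Finset.smul_sum, norm_smul, Real.norm_of_nonneg hs.le]
  have hle : ∀ v ∈ auxQ d, ‖∑ i, v i • x i‖ ≤ ∑ i, v i := by
    intro v hv
    refine (norm_sum_le _ _).trans (Finset.sum_le_sum fun i _ => ?_)
    rw [norm_smul, hx, mul_one, Real.norm_of_nonneg (hv i trivial)]
  let h : (Fin d → ℝ) → ℝ := fun v =>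
    exp (-∑ k, v k) + ∑ i, v i * exp (-∑ k, v k) +
      ∑ i, ∑ j, (1 - inner ℝ (x i) (x j)) / 2 * (v i * v j * exp (-∑ k, v k))
  have hh : ∀ v, h v = (1 + ∑ i, v i) * exp (-∑ i, v i) +
      exp (-∑ i, v i) * (((∑ i, v i) ^ 2 - ‖∑ i, v i • x i‖ ^ 2) / 2) := by
    intro v
    have e : ‖∑ i, v i • x i‖ ^ 2 = ∑ i, ∑ j, v i * v j * inner ℝ (x i) (x j) := by
      rw [← real_inner_self_eq_norm_sq, sum_inner]
      refine Finset.sum_congr rfl fun i _ => ?_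
      rw [inner_sum]
      refine Finset.sum_congr rfl fun j _ => ?_
      rw [real_inner_smul_left, real_inner_smul_right, mul_assoc]
    have e2 : (∑ i, v i) ^ 2 = ∑ i, ∑ j, v i * v j := by
      rw [sq, Finset.sum_mul_sum]
    rw [e, e2, ← Finset.sum_sub_distrib, Finset.sum_div, Finset.mul_sum]
    simp only [h]
    rw [← Finset.sum_mul, add_mul, one_mul]
    congr 1
    refine Finset.sum_congr rfl fun i _ => ?_
    rw [← Finset.sum_sub_distrib, Finset.sum_div, Finset.mul_sum]
    refine Finset.sum_congr rfl fun j _ => ?_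
    ring
  have i0 := (aux_mono0 d).1
  have i1 : Integrable (fun v : Fin d → ℝ => ∑ i, v i * exp (-∑ k, v k))
      (volume.restrict (auxQ d)) := integrable_finsetSum _ fun i _ => (aux_mono1 d i).1
  have i2' : ∀ i, Integrable (fun v : Fin d → ℝ => ∑ j, (1 - inner ℝ (x i) (x j)) / 2 *
      (v i * v j * exp (-∑ k, v k))) (volume.restrict (auxQ d)) :=
    fun i => integrable_finsetSum _ fun j _ => (aux_mono2 d i j).1.const_mul _
  have i2 : Integrable (fun v : Fin d → ℝ => ∑ i, ∑ j, (1 - inner ℝ (x i) (x j)) / 2 *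
      (v i * v j * exp (-∑ k, v k))) (volume.restrict (auxQ d)) :=
    integrable_finsetSum _ fun i _ => i2' i
  have hint : Integrable h (volume.restrict (auxQ d)) := (i0.add i1).add i2
  have hval : ∫ v in auxQ d, h v = 1 + d + ((d : ℝ) ^ 2 - ‖∑ i, x i‖ ^ 2) / 2 := by
    simp only [h]
    have c1 : ∫ v in auxQ d, ∑ i, v i * exp (-∑ k, v k) = d := by
      rw [integral_finsetSum _ fun i _ => (aux_mono1 d i).1]
      simp [(aux_mono1 d _).2]
    have c2 : ∫ v in auxQ d, ∑ i, ∑ j, (1 - inner ℝ (x i) (x j)) / 2 *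
      (v i * v j * exp (-∑ k, v k)) = ∑ i, ∑ j, (1 - inner ℝ (x i) (x j)) / 2 := by
      rw [integral_finsetSum _ fun i _ => i2' i]
      refine Finset.sum_congr rfl fun i _ => ?_
      rw [integral_finsetSum _ fun j _ => (aux_mono2 d i j).1.const_mul _]
      refine Finset.sum_congr rfl fun j _ => ?_
      rw [integral_const_mul]
      by_cases hij : i = j
      · subst hij
        simp [hx]
      · rw [(aux_mono2 d i j).2 hij, mul_one]
    have e : ‖∑ i, x i‖ ^ 2 = ∑ i, ∑ j, inner ℝ (x i) (x j) := by
      rw [← real_inner_self_eq_norm_sq, sum_inner]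
      simp_rw [inner_sum]
    have i01 : Integrable (fun v : Fin d → ℝ => exp (-∑ k, v k) + ∑ i, v i * exp (-∑ k, v k))
      (volume.restrict (auxQ d)) := i0.add i1
    rw [integral_add i01 i2, integral_add i0 i1, (aux_mono0 d).2, c1, c2, e]
    simp_rw [← Finset.sum_div, Finset.sum_sub_distrib]
    simp [sq]
  rw [← hval, ofReal_integral_eq_lintegral_ofReal hint]
  · refine setLIntegral_mono' (auxQ_meas d) fun v hv => ENNReal.ofReal_le_ofReal ?_
    rw [hh]
    exact aux_phi (norm_nonneg _) (hle v hv)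
  · refine (ae_restrict_iff' (auxQ_meas d)).2 (Filter.Eventually.of_forall fun v hv => ?_)
    show 0 ≤ h v
    rw [hh]
    have h1 := hle v hv
    have h2 := norm_nonneg (∑ i, v i • x i)
    have h3 := exp_pos (-∑ i, v i)
    have h4 : 0 ≤ (∑ i, v i) ^ 2 - ‖∑ i, v i • x i‖ ^ 2 := by nlinarith
    have h5 : 0 ≤ ∑ i, v i := h2.trans h1
    positivity

lemma aux_simplex (d : ℕ) :
    ENNReal.ofReal ((d + 1).factorial : ℝ) * volume (auxQ d ∩ {v | ∑ i, v i ≤ 1}) =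
      ENNReal.ofReal (1 + d) := by
  have h0 : ∀ v ∈ auxQ d, 0 ≤ ∑ i, v i := fun v hv => Finset.sum_nonneg fun i _ => hv i trivial
  rw [← aux_layer d (fun v => ∑ i, v i) (by fun_prop) h0 ?_]
  swap
  · intro s hs v
    simp [Finset.mul_sum]
  have i0 := (aux_mono0 d).1
  have i1 : Integrable (fun v : Fin d → ℝ => ∑ i, v i * exp (-∑ k, v k))
      (volume.restrict (auxQ d)) := integrable_finsetSum _ fun i _ => (aux_mono1 d i).1
  have c1 : ∫ v in auxQ d, ∑ i, v i * exp (-∑ k, v k) = d := by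
    rw [integral_finsetSum _ fun i _ => (aux_mono1 d i).1]
    simp [(aux_mono1 d _).2]
  have e : ∀ v : Fin d → ℝ, (1 + ∑ i, v i) * exp (-∑ i, v i) =
      exp (-∑ k, v k) + ∑ i, v i * exp (-∑ k, v k) := by
    intro v
    rw [← Finset.sum_mul, add_mul, one_mul]
  have hint : Integrable (fun v : Fin d → ℝ => exp (-∑ k, v k) + ∑ i, v i * exp (-∑ k, v k))
      (volume.restrict (auxQ d)) := i0.add i1
  have hval : ∫ v in auxQ d, (exp (-∑ k, v k) + ∑ i, v i * exp (-∑ k, v k)) = 1 + d := by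
    rw [integral_add i0 i1, (aux_mono0 d).2, c1]
  rw [← hval, ofReal_integral_eq_lintegral_ofReal hint]
  · simp_rw [e]
  · refine (ae_restrict_iff' (auxQ_meas d)).2 (Filter.Eventually.of_forall fun v hv => ?_)
    show 0 ≤ exp (-∑ k, v k) + ∑ i, v i * exp (-∑ k, v k)
    rw [← e]
    have := h0 v hv
    positivity

theorem cone_volume_difference_lower_bound (d : ℕ) (hd : 1 ≤ d)
    (x : Fin d → EuclideanSpace ℝ (Fin d)) (hx : ∀ i, ‖x i‖ = 1)
    (S : Set (EuclideanSpace ℝ (Fin d))) (hS : S = convexHull ℝ (Set.range x))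
    (rpS : Set (EuclideanSpace ℝ (Fin d)))
    (hrpS : rpS = {ξ | ‖ξ‖ = 1 ∧ (segment ℝ 0 ξ ∩ S).Nonempty})
    (coneS : Set (EuclideanSpace ℝ (Fin d)))
    (hconeS : coneS = convexHull ℝ (insert (0 : EuclideanSpace ℝ (Fin d)) (Set.range x)))
    (coneRpS : Set (EuclideanSpace ℝ (Fin d)))
    (hconeRpS : coneRpS = {z | ∃ t : ℝ, ∃ ξ ∈ rpS, 0 ≤ t ∧ t ≤ 1 ∧ z = t • ξ}) :
    (volume coneRpS).toReal - (volume coneS).toReal ≥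
      ((d : ℝ) ^ 2 / (2 * ((d : ℝ) + 1))) *
        (1 - ‖(1 / (d : ℝ)) • ∑ i, x i‖ ^ 2) * (volume coneS).toReal := by
  have hd0 : (0:ℝ) < d := by exact_mod_cast hd
  set K : ℝ := ((d : ℝ) ^ 2 / (2 * ((d : ℝ) + 1))) *
        (1 - ‖(1 / (d : ℝ)) • ∑ i, x i‖ ^ 2) with hK
  have hK' : (1 + K) * (1 + d) = 1 + d + ((d : ℝ) ^ 2 - ‖∑ i, x i‖ ^ 2) / 2 := by
    rw [hK, norm_smul, Real.norm_of_nonneg (by positivity)]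
    field_simp
    ring
  set T : Set (Fin d → ℝ) := auxQ d ∩ {v | ∑ i, v i ≤ 1} with hT
  set A : Set (Fin d → ℝ) := auxQ d ∩ {v | ‖∑ i, v i • x i‖ ≤ 1} with hA
  have hTA : ENNReal.ofReal (1 + K) * volume T ≤ volume A := by
    have h1 := aux_key d x hx
    rw [← hK', mul_comm, ENNReal.ofReal_mul (by positivity), ← aux_simplex d, mul_assoc,
      mul_comm (volume _)] at h1
    refine (ENNReal.mul_le_mul_iff_right ?_ ENNReal.ofReal_ne_top).1 h1
    simp [Nat.factorial_ne_zero]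
  let M : EuclideanSpace ℝ (Fin d) →ₗ[ℝ] EuclideanSpace ℝ (Fin d) :=
    { toFun := fun v => ∑ i, v i • x i
      map_add' := by intro v w; simp [add_smul, Finset.sum_add_distrib]
      map_smul' := by intro c v; simp [mul_smul, Finset.smul_sum] }
  have hM : ∀ v, M v = ∑ i, v i • x i := fun v => rfl
  have hvol : ∀ B : Set (Fin d → ℝ), volume (M '' (WithLp.ofLp ⁻¹' B)) =
      ENNReal.ofReal |LinearMap.det M| * volume B := by
    intro B
    rw [Measure.addHaar_image_linearMap]
    congr 1
    exact (EuclideanSpace.volume_preserving_symm_measurableEquiv_toLp (Fin d)).measure_preimage_equiv B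
  have hsub1 : coneS ⊆ M '' (WithLp.ofLp ⁻¹' T) := by
    rw [hconeS]
    refine convexHull_min ?_ ?_
    · intro z hz
      rcases hz with rfl | ⟨i, rfl⟩
      · refine ⟨0, ⟨fun i _ => ?_, ?_⟩, map_zero M⟩
        · simp
        · simp
      · refine ⟨EuclideanSpace.single i 1, ⟨fun j _ => ?_, ?_⟩, ?_⟩
        · by_cases hj : j = i <;> simp [Pi.single_apply, hj]
        · simp [Pi.single_apply]
        · simp [hM, Pi.single_apply]
    · refine Convex.linear_image ?_ M
      rintro v ⟨hv1, hv2⟩ w ⟨hw1, hw2⟩ a b ha hb hab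
      have hv2 : ∑ i, v i ≤ 1 := hv2
      have hw2 : ∑ i, w i ≤ 1 := hw2
      refine ⟨fun i _ => ?_, ?_⟩
      · have h1 : 0 ≤ v i := hv1 i trivial
        have h2 : 0 ≤ w i := hw1 i trivial
        show 0 ≤ a * v i + b * w i
        positivity
      · show ∑ i, (a * v i + b * w i) ≤ 1
        rw [Finset.sum_add_distrib, ← Finset.mul_sum, ← Finset.mul_sum]
        nlinarith
  have hsub2 : M '' (WithLp.ofLp ⁻¹' A) ⊆ coneRpS := by
    rintro _ ⟨v, ⟨hv1, hv2⟩, rfl⟩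
    have hv2 : ‖M v‖ ≤ 1 := hv2
    have hv1 : ∀ i, 0 ≤ v i := fun i => hv1 i trivial
    rw [hconeRpS, hrpS]
    by_cases hz : M v = 0
    · refine ⟨0, x ⟨0, hd⟩, ⟨hx _, x ⟨0, hd⟩, right_mem_segment _ _ _, ?_⟩, le_rfl, zero_le_one, ?_⟩
      · rw [hS]; exact subset_convexHull _ _ ⟨_, rfl⟩
      · simp [hz]
    · have hn : 0 < ‖M v‖ := norm_pos_iff.2 hz
      have hle : ‖M v‖ ≤ ∑ i, v i := by
        rw [hM]
        refine (norm_sum_le _ _).trans (Finset.sum_le_sum fun i _ => ?_)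
        rw [norm_smul, hx, mul_one, Real.norm_of_nonneg (hv1 i)]
      have hs : 0 < ∑ i, v i := hn.trans_le hle
      refine ⟨‖M v‖, ‖M v‖⁻¹ • M v, ⟨?_, (∑ i, v i)⁻¹ • M v, ?_, ?_⟩, hn.le, hv2, ?_⟩
      · rw [norm_smul, norm_inv, norm_norm, inv_mul_cancel₀ hn.ne']
      · rw [segment_eq_image']
        refine ⟨‖M v‖ / ∑ i, v i, ⟨by positivity, (div_le_one hs).2 hle⟩, ?_⟩
        simp only [sub_zero, zero_add, smul_smul]
        congr 1
        field_simp
      · rw [hS]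
        have := Finset.centerMass_mem_convexHull (R := ℝ) (s := Set.range x) Finset.univ
          (w := fun i => v i) (fun i _ => hv1 i) hs (z := x) (fun i _ => ⟨i, rfl⟩)
        exact this
      · rw [smul_smul, mul_inv_cancel₀ hn.ne', one_smul]
  have hfin : volume coneRpS ≠ ⊤ := by
    refine ne_top_of_le_ne_top (measure_closedBall_lt_top (x := (0 : EuclideanSpace ℝ (Fin d)))
      (r := 1)).ne (measure_mono ?_)
    rw [hconeRpS, hrpS]
    rintro z ⟨t, ξ, ⟨hξ, _⟩, ht0, ht1, rfl⟩
    simp [norm_smul, hξ, abs_of_nonneg ht0, ht1]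
  have hmain : ENNReal.ofReal (1 + K) * volume coneS ≤ volume coneRpS := by
    calc _ ≤ ENNReal.ofReal (1 + K) * (ENNReal.ofReal |LinearMap.det M| * volume T) := by
          rw [← hvol]; gcongr
      _ = ENNReal.ofReal |LinearMap.det M| * (ENNReal.ofReal (1 + K) * volume T) := by ring
      _ ≤ ENNReal.ofReal |LinearMap.det M| * volume A := by gcongr
      _ ≤ _ := by rw [← hvol]; exact measure_mono hsub2
  have := ENNReal.toReal_mono hfin hmain
  rw [ENNReal.toReal_mul, ENNReal.toReal_ofReal'] at this
  have h3 : (1 + K) * (volume coneS).toReal ≤ max (1 + K) 0 * (volume coneS).toReal :=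
    mul_le_mul_of_nonneg_right (le_max_left _ _) ENNReal.toReal_nonneg
  linarith
end

section
/- There exist positive absolute constants c₁ and c₂ such that for all d ≥ 2, all n ≥ (c₁·d)^{(d−1)/2}, and every polytope P_n with n vertices contained in the Euclidean unit ball B₂^d, one has vol_d(B₂^d) − vol_d(P_n) ≥ c₂ · d · vol_d(B₂^d) · n^{−2/(d−1)}. -/
open MeasureTheory Real

lemma cap_volume {d : ℕ} (hd : 2 ≤ d) (u : EuclideanSpace ℝ (Fin d)) (hu : ‖u‖ = 1)
    (τ : ℝ) (hτ : 0 < τ) :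
    volume {x : EuclideanSpace ℝ (Fin d) | ‖x‖ ≤ 1 ∧ 1 - 2 * τ ^ 2 ≤ inner ℝ u x} ≤
      ENNReal.ofReal ((4 * τ) ^ d * τ) *
        volume (Metric.closedBall (0 : EuclideanSpace ℝ (Fin d)) 1) := by
  set A : EuclideanSpace ℝ (Fin d) →ₗ[ℝ] EuclideanSpace ℝ (Fin d) :=
    (4 * τ) • LinearMap.transvection ((τ - 1) • (innerₛₗ ℝ u)) u with hA
  have huu : inner ℝ u u = (1 : ℝ) := by rw [real_inner_self_eq_norm_sq, hu]; norm_num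
  have hdet : LinearMap.det A = (4 * τ) ^ d * τ := by
    rw [hA, LinearMap.det_smul, LinearMap.transvection.det]
    simp [hu]
  have hAx : ∀ y, A y = (4 * τ) • (y + ((τ - 1) * inner ℝ u y) • u) := by
    intro y; simp [hA, LinearMap.transvection.apply]
  have hsub : {x : EuclideanSpace ℝ (Fin d) | ‖x‖ ≤ 1 ∧ 1 - 2 * τ ^ 2 ≤ inner ℝ u x} ⊆
      (fun y => (1 - 2 * τ ^ 2) • u + y) '' (A '' Metric.closedBall 0 1) := by
    rintro x ⟨hx1, hx2⟩
    set p : ℝ := inner ℝ u x - (1 - 2 * τ ^ 2) with hp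
    have hux : inner ℝ u x ≤ (1 : ℝ) := by
      have := real_inner_le_norm u x
      rw [hu] at this; linarith
    set z := x - (1 - 2 * τ ^ 2) • u with hz
    have hzu : inner ℝ u z = p := by
      rw [hz, inner_sub_right, inner_smul_right, huu, hp]; ring
    have hzz : ‖z‖ ^ 2 = ‖x‖ ^ 2 - (inner ℝ u x) ^ 2 + p ^ 2 := by
      rw [hz, norm_sub_sq_real, inner_smul_right, norm_smul, hu, real_inner_comm, hp]
      simp only [mul_one, norm_eq_abs, sq_abs]
      ring
    refine ⟨z, ⟨(1 / (4 * τ)) • (z + ((1 / τ - 1) * p) • u), ?_, ?_⟩, by simp [hz]⟩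
    · rw [mem_closedBall_zero_iff]
      have h1 : ‖z + ((1 / τ - 1) * p) • u‖ ^ 2 = ‖z‖ ^ 2 - p ^ 2 + p ^ 2 / τ ^ 2 := by
        rw [norm_add_sq_real, inner_smul_right, norm_smul, hu, real_inner_comm, hzu]
        simp only [mul_one, norm_eq_abs, sq_abs]
        field_simp
        ring
      have hp0 : 0 ≤ p := by linarith
      have hp1 : p ≤ 2 * τ ^ 2 := by linarith
      have h2 : p ^ 2 / τ ^ 2 ≤ 4 * τ ^ 2 := by
        rw [div_le_iff₀ (by positivity)]
        nlinarith
      have h3 : ‖x‖ ^ 2 - (inner ℝ u x) ^ 2 ≤ 4 * τ ^ 2 := by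
        have : ‖x‖ ^ 2 ≤ 1 := by nlinarith [norm_nonneg x]
        have h4 : (inner ℝ u x : ℝ) = 1 - (1 - inner ℝ u x) := by ring
        nlinarith [sq_nonneg (1 - inner ℝ u x : ℝ)]
      have h5 : ‖z + ((1 / τ - 1) * p) • u‖ ≤ 4 * τ := by
        apply le_of_sq_le_sq _ (by positivity)
        rw [h1, hzz]; nlinarith
      rw [norm_smul, norm_of_nonneg (by positivity : (0:ℝ) ≤ 1 / (4 * τ)),
        one_div_mul_eq_div, div_le_one (by positivity)]
      exact h5
    · rw [hAx, inner_smul_right, inner_add_right, inner_smul_right, huu, hzu]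
      rw [smul_add, smul_smul, smul_add, smul_smul, smul_smul, add_assoc, ← add_smul]
      have e1 : 4 * τ * (1 / (4 * τ)) = 1 := by field_simp
      have e2 : 4 * τ * (1 / (4 * τ)) * ((1 / τ - 1) * p) +
          4 * τ * ((τ - 1) * (1 / (4 * τ) * (p + (1 / τ - 1) * p * 1))) = 0 := by
        field_simp; ring
      rw [e2, e1]; simp
  refine (measure_mono hsub).trans ?_
  rw [Set.image_add_left, measure_preimage_add, Measure.addHaar_image_linearMap, hdet,
    abs_of_nonneg (by positivity)]

lemma hull_subset {d : ℕ} (V : Finset (EuclideanSpace ℝ (Fin d)))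
    (x : EuclideanSpace ℝ (Fin d)) (hx : x ∈ convexHull ℝ (V : Set (EuclideanSpace ℝ (Fin d)))) :
    ∃ v ∈ V, ‖x‖ ^ 2 ≤ inner ℝ v x := by
  by_contra! h
  have hc : Convex ℝ {w : EuclideanSpace ℝ (Fin d) | inner ℝ x w < ‖x‖ ^ 2} :=
    convex_halfSpace_lt (innerₛₗ ℝ x).isLinear _
  have := convexHull_min (s := (V : Set (EuclideanSpace ℝ (Fin d))))
    (fun v hv => by
      have := h v hv
      rw [real_inner_comm] at this
      exact this) hc hx
  simp only [Set.mem_ofPred_eq, real_inner_self_eq_norm_sq, lt_irrefl] at this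

lemma hull_volume {d : ℕ} (hd : 2 ≤ d) (V : Finset (EuclideanSpace ℝ (Fin d)))
    (hV : ↑V ⊆ Metric.closedBall (0 : EuclideanSpace ℝ (Fin d)) 1)
    (τ : ℝ) (hτ : 0 < τ) (hτ1 : τ ≤ 1 / 2) :
    (volume (convexHull ℝ (V : Set (EuclideanSpace ℝ (Fin d))))).toReal ≤
      ((1 - τ ^ 2) ^ d + V.card * ((4 * τ) ^ d * τ)) *
        (volume (Metric.closedBall (0 : EuclideanSpace ℝ (Fin d)) 1)).toReal := by
  set B := Metric.closedBall (0 : EuclideanSpace ℝ (Fin d)) 1 with hB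
  have hBfin : volume B ≠ ⊤ := (isCompact_closedBall _ _).measure_ne_top
  have hr : 0 ≤ 1 - τ ^ 2 := by nlinarith
  have hsub : convexHull ℝ (V : Set (EuclideanSpace ℝ (Fin d))) ⊆
      Metric.closedBall 0 (1 - τ ^ 2) ∪
      ⋃ v ∈ V, {x | ‖x‖ ≤ 1 ∧ 1 - 2 * τ ^ 2 ≤ inner ℝ (‖v‖⁻¹ • v) x ∧ v ≠ 0} := by
    intro x hx
    have hxB : ‖x‖ ≤ 1 := by
      have := convexHull_min hV (convex_closedBall _ _) hx
      simpa [hB] using this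
    by_cases hxr : ‖x‖ ≤ 1 - τ ^ 2
    · left; simpa using hxr
    · right
      push Not at hxr
      obtain ⟨v, hv, hvx⟩ := hull_subset V x hx
      have hv1 : ‖v‖ ≤ 1 := by simpa [hB] using hV hv
      have h1 : 1 - 2 * τ ^ 2 ≤ inner ℝ v x := by nlinarith
      have h0 : 0 < (inner ℝ v x : ℝ) := by nlinarith
      have hv0 : v ≠ 0 := by
        rintro rfl; simp at h0
      simp only [Set.mem_iUnion]
      refine ⟨v, hv, hxB, ?_, hv0⟩
      rw [inner_smul_left]
      have : 1 ≤ ‖v‖⁻¹ := (one_le_inv₀ (norm_pos_iff.2 hv0)).2 hv1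
      simp only [conj_trivial]
      nlinarith
  have key : volume (convexHull ℝ (V : Set (EuclideanSpace ℝ (Fin d)))) ≤
      ENNReal.ofReal ((1 - τ ^ 2) ^ d + V.card * ((4 * τ) ^ d * τ)) * volume B := by
    refine (measure_mono hsub).trans ((measure_union_le _ _).trans ?_)
    rw [ENNReal.ofReal_add (by positivity) (by positivity), add_mul]
    refine add_le_add ?_ ?_
    · rw [Measure.addHaar_closedBall' _ _ hr]
      simp [hB]
    · refine (measure_biUnion_finset_le _ _).trans ?_
      rw [ENNReal.ofReal_mul (by positivity), ENNReal.ofReal_natCast, mul_assoc, ← nsmul_eq_mul]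
      refine Finset.sum_le_card_nsmul _ _ _ (fun v hv => ?_)
      by_cases hv0 : v = 0
      · simp [hv0]
      · refine (measure_mono ?_).trans (cap_volume hd (‖v‖⁻¹ • v) ?_ τ hτ)
        · rintro x ⟨h1, h2, _⟩; exact ⟨h1, h2⟩
        · rw [norm_smul, norm_inv, norm_norm, inv_mul_cancel₀ (norm_ne_zero_iff.2 hv0)]
  have := ENNReal.toReal_mono (ENNReal.mul_ne_top ENNReal.ofReal_ne_top hBfin) key
  rwa [ENNReal.toReal_mul, ENNReal.toReal_ofReal (by positivity)] at this

theorem main_lower_bound_polytope_approx :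
    ∃ c₁ c₂ : ℝ, 0 < c₁ ∧ 0 < c₂ ∧
      ∀ d n : ℕ, 2 ≤ d → (c₁ * d) ^ (((d : ℝ) - 1) / 2) ≤ (n : ℝ) →
        ∀ V : Finset (EuclideanSpace ℝ (Fin d)), V.card = n →
          ↑V ⊆ Metric.closedBall (0 : EuclideanSpace ℝ (Fin d)) 1 →
          (volume (Metric.closedBall (0 : EuclideanSpace ℝ (Fin d)) 1)).toReal -
              (volume (convexHull ℝ (V : Set (EuclideanSpace ℝ (Fin d))))).toReal ≥
            c₂ * d * (volume (Metric.closedBall (0 : EuclideanSpace ℝ (Fin d)) 1)).toReal *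
              (n : ℝ) ^ (-(2 / ((d : ℝ) - 1))) := by
  refine ⟨1, 1 / 2048, by norm_num, by norm_num, ?_⟩
  intro d n hd hn V hcard hV
  rw [one_mul] at hn
  have hd2 : (2 : ℝ) ≤ d := by exact_mod_cast hd
  have hd1 : (0 : ℝ) < (d : ℝ) - 1 := by linarith
  have hn0 : (0 : ℝ) < n := lt_of_lt_of_le (by positivity) hn
  set q : ℝ := (n : ℝ) ^ (-(1 / ((d : ℝ) - 1))) with hq
  have hq0 : 0 < q := by positivity
  have hq2 : (n : ℝ) ^ (-(2 / ((d : ℝ) - 1))) = q ^ 2 := by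
    rw [hq, ← rpow_natCast, ← rpow_mul hn0.le]; congr 1; push_cast; ring
  have hqd : (n : ℝ) * q ^ (d - 1) = 1 := by
    rw [hq, ← rpow_natCast, ← rpow_mul hn0.le, Nat.cast_sub (by omega), Nat.cast_one,
      neg_mul, one_div_mul_cancel hd1.ne', rpow_neg_one, mul_inv_cancel₀ hn0.ne']
  have hdq : (d : ℝ) * q ^ 2 ≤ 1 := by
    have h1 := rpow_le_rpow (by positivity) hn (by positivity : 0 ≤ 2 / ((d : ℝ) - 1))
    rw [← rpow_mul (by positivity), show ((d : ℝ) - 1) / 2 * (2 / ((d : ℝ) - 1)) = 1 by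
      field_simp, rpow_one] at h1
    rw [← hq2, rpow_neg hn0.le, ← div_eq_mul_inv, div_le_one (by positivity)]
    exact h1
  have hq1 : q ≤ 1 := by nlinarith
  have hvol := hull_volume hd V hV (q / 32) (by positivity) (by linarith)
  rw [hcard] at hvol
  set κ := (volume (Metric.closedBall (0 : EuclideanSpace ℝ (Fin d)) 1)).toReal with hκ
  have hκ0 : 0 ≤ κ := ENNReal.toReal_nonneg
  set t : ℝ := (q / 32) ^ 2 with ht
  have ht0 : 0 ≤ t := by positivity
  have hdt : (d : ℝ) * t ≤ 1 / 1024 := by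
    rw [ht, div_pow]; linarith
  have hcap : (n : ℝ) * ((4 * (q / 32)) ^ d * (q / 32)) ≤ t / 2 := by
    have e : (4 * (q / 32)) ^ d = (q ^ (d - 1) * (1 / 8) ^ (d - 1)) * (4 * (q / 32)) := by
      rw [← mul_pow]
      conv_lhs => rw [← Nat.sub_add_cancel (by omega : 1 ≤ d), pow_succ]
      congr 2; ring
    have e8 : (1 / 8 : ℝ) ^ (d - 1) ≤ 1 / 8 := by
      calc (1 / 8 : ℝ) ^ (d - 1) ≤ (1 / 8 : ℝ) ^ 1 :=
            pow_le_pow_of_le_one (by norm_num) (by norm_num) (by omega)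
        _ = 1 / 8 := by norm_num
    calc (n : ℝ) * ((4 * (q / 32)) ^ d * (q / 32))
        = (n * q ^ (d - 1)) * ((1 / 8) ^ (d - 1) * (4 * t)) := by rw [e, ht]; ring
      _ = (1 / 8) ^ (d - 1) * (4 * t) := by rw [hqd, one_mul]
      _ ≤ 1 / 8 * (4 * t) := by gcongr
      _ = t / 2 := by ring
  have hpow : (1 - t) ^ d ≤ 1 - 3 / 4 * (d * t) := by
    have ht1 : t ≤ 1 := by nlinarith
    have h1 : 1 + (d : ℝ) * t ≤ (1 + t) ^ d := one_add_mul_le_pow (by linarith) d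
    have h2 : (1 - t) ^ d * (1 + t) ^ d ≤ 1 := by
      rw [← mul_pow]; apply pow_le_one₀ <;> nlinarith
    have h3 : 0 ≤ (1 - t) ^ d := pow_nonneg (by linarith) d
    have h4 : (1 - t) ^ d * (1 + d * t) ≤ 1 := (mul_le_mul_of_nonneg_left h1 h3).trans h2
    have h5 : 0 ≤ (d : ℝ) * t := by positivity
    by_contra! h
    nlinarith
  rw [hq2]
  have hq2t : q ^ 2 = 1024 * t := by rw [ht]; ring
  rw [hq2t]
  have hb : (1 - t) ^ d + n * ((4 * (q / 32)) ^ d * (q / 32)) ≤ 1 - 1 / 2 * (d * t) := by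
    nlinarith
  have := mul_le_mul_of_nonneg_right hb hκ0
  have e : 1 / 2048 * (d : ℝ) * κ * (1024 * t) = 1 / 2 * (d * t) * κ := by ring
  rw [e]
  linarith
end
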